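/- arXiv:2010.07423 — 5 statements merged into one kernel-verified Lean document; each statement's English description precedes it below -/
import Mathlib

section
/- Let S be a nonempty finite set, let P be a probability distribution on S^4 satisfying the constraints C_L and C_M, and let N ≥ 2 be an integer. Then summing the snake distribution Snake_N(x) over all values of the first-row variables {x(i,1) : 1 ≤ i ≤ N} yields, as a function of the second-row variables, ∏_{i=1}^{N−1} P_{ab}(x(i,2), x(i+1,2)) / ∏_{i=2}^{N−1} P_a(x(i,2)) (with the convention that this quotient is 0 whenever its numerator vanishes). -/
open Finset

/-- A probability distribution on a finite type: nonnegative and sums to 1. -/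
def IsProbDist {α : Type*} [Fintype α] (Q : α → ℝ) : Prop :=
  (∀ x, 0 ≤ Q x) ∧ ∑ x, Q x = 1

/-- Shannon entropy of a finitely supported distribution. -/
noncomputable def entropy {α : Type*} [Fintype α] (Q : α → ℝ) : ℝ :=
  -∑ x, Q x * Real.log (Q x)

section Marginals

variable {S : Type*} [Fintype S]

/-- Marginal on the bottom pair (a, b). -/
def margAB (P : S × S × S × S → ℝ) : S × S → ℝ :=
  fun p => ∑ z : S, ∑ w : S, P (p.1, p.2, z, w)

/-- Marginal on the top pair (c, d). -/
def margCD (P : S × S × S × S → ℝ) : S × S → ℝ :=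
  fun p => ∑ x : S, ∑ y : S, P (x, y, p.1, p.2)

/-- Marginal on the left vertical pair (a, c). -/
def margAC (P : S × S × S × S → ℝ) : S × S → ℝ :=
  fun p => ∑ y : S, ∑ w : S, P (p.1, y, p.2, w)

/-- Marginal on the right vertical pair (b, d). -/
def margBD (P : S × S × S × S → ℝ) : S × S → ℝ :=
  fun p => ∑ x : S, ∑ z : S, P (x, p.1, z, p.2)

/-- Marginal on the single site a. -/
def margA (P : S × S × S × S → ℝ) : S → ℝ :=
  fun a => ∑ y : S, ∑ z : S, ∑ w : S, P (a, y, z, w)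

/-- Marginal on the single site b. -/
def margB (P : S × S × S × S → ℝ) : S → ℝ :=
  fun b => ∑ x : S, ∑ z : S, ∑ w : S, P (x, b, z, w)

/-- Marginal on the single site c. -/
def margC (P : S × S × S × S → ℝ) : S → ℝ :=
  fun c => ∑ x : S, ∑ y : S, ∑ w : S, P (x, y, c, w)

/-- Marginal on the single site d. -/
def margD (P : S × S × S × S → ℝ) : S → ℝ :=
  fun d => ∑ x : S, ∑ y : S, ∑ z : S, P (x, y, z, d)

/-- Marginal on the triple (a, b, d). -/
def margABD (P : S × S × S × S → ℝ) : S × S × S → ℝ :=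
  fun p => ∑ z : S, P (p.1, p.2.1, z, p.2.2)

/-- Marginal on the triple (a, c, d). -/
def margACD (P : S × S × S × S → ℝ) : S × S × S → ℝ :=
  fun p => ∑ y : S, P (p.1, y, p.2.1, p.2.2)

/-- The linear (translation-invariance) constraints `C_L`. -/
def CL (P : S × S × S × S → ℝ) : Prop :=
  margAB P = margCD P ∧ margAC P = margBD P

/-- The Markovian constraints `C_M`. -/
def CM (P : S × S × S × S → ℝ) : Prop :=
  entropy (margAC P) + entropy (margAB P) - entropy (margA P) - entropy (margABD P) = 0 ∧
  entropy (margAC P) + entropy (margAB P) - entropy (margA P) - entropy (margACD P) = 0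

end Marginals

section Grid

variable {S : Type*} [Fintype S] [DecidableEq S]

/-- The 2×2 cluster of a configuration whose bottom-left corner is at
(0-indexed) position `(i, j)`: (bottom-left, bottom-right, top-left, top-right). -/
def cluster {N M : ℕ} (ω : Fin N × Fin M → S) (i : Fin (N - 1)) (j : Fin (M - 1)) :
    S × S × S × S :=
  (ω (⟨i.1, by have := i.isLt; omega⟩, ⟨j.1, by have := j.isLt; omega⟩),
   ω (⟨i.1 + 1, by have := i.isLt; omega⟩, ⟨j.1, by have := j.isLt; omega⟩),
   ω (⟨i.1, by have := i.isLt; omega⟩, ⟨j.1 + 1, by have := j.isLt; omega⟩),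
   ω (⟨i.1 + 1, by have := i.isLt; omega⟩, ⟨j.1 + 1, by have := j.isLt; omega⟩))

/-- The pushforward (marginal) of a distribution on configurations under the map
sending a configuration to its 2×2 cluster at position `(i, j)`. -/
def marginalAt {N M : ℕ} (Q : (Fin N × Fin M → S) → ℝ)
    (i : Fin (N - 1)) (j : Fin (M - 1)) : S × S × S × S → ℝ :=
  fun p => ∑ ω : Fin N × Fin M → S, if cluster ω i j = p then Q ω else 0

/-- A distribution `Q` on `N × M` configurations is consistent with `P` if every 2×2
cluster marginal of `Q` equals `P`. -/
def Consistent {N M : ℕ} (Q : (Fin N × Fin M → S) → ℝ) (P : S × S × S × S → ℝ) : Prop :=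
  ∀ (i : Fin (N - 1)) (j : Fin (M - 1)), marginalAt Q i j = P

end Grid
section Ansatz

variable {S : Type*} [Fintype S] [DecidableEq S]

/-- Numerator of the ansatz distribution `Q_{N,M}`. -/
noncomputable def QNMnum (P : S × S × S × S → ℝ) (N M : ℕ) (ω : Fin N × Fin M → S) : ℝ :=
  (∏ i : Fin (N - 1), ∏ j : Fin (M - 1), P (cluster ω i j)) *
  ∏ i : Fin (N - 2), ∏ j : Fin (M - 2),
    margA P (ω (⟨i.1 + 1, by have := i.isLt; omega⟩, ⟨j.1 + 1, by have := j.isLt; omega⟩))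

/-- Denominator of the ansatz distribution `Q_{N,M}`. -/
noncomputable def QNMden (P : S × S × S × S → ℝ) (N M : ℕ) (ω : Fin N × Fin M → S) : ℝ :=
  (∏ i : Fin (N - 2), ∏ j : Fin (M - 1),
    margAC P (ω (⟨i.1 + 1, by have := i.isLt; omega⟩, ⟨j.1, by have := j.isLt; omega⟩),
              ω (⟨i.1 + 1, by have := i.isLt; omega⟩, ⟨j.1 + 1, by have := j.isLt; omega⟩))) *
  ∏ i : Fin (N - 1), ∏ j : Fin (M - 2),
    margAB P (ω (⟨i.1, by have := i.isLt; omega⟩, ⟨j.1 + 1, by have := j.isLt; omega⟩),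
              ω (⟨i.1 + 1, by have := i.isLt; omega⟩, ⟨j.1 + 1, by have := j.isLt; omega⟩))

open Classical in
/-- The explicitly constructed ansatz distribution `Q_{N,M}`, with the convention that it
vanishes whenever its numerator vanishes. -/
noncomputable def QNM (P : S × S × S × S → ℝ) (N M : ℕ) : (Fin N × Fin M → S) → ℝ :=
  fun ω => if QNMnum P N M ω = 0 then 0 else QNMnum P N M ω / QNMden P N M ω

/-- Numerator of the snake distribution. -/
noncomputable def snakeNum (P : S × S × S × S → ℝ) (N : ℕ) (x : Fin N × Fin 2 → S) : ℝ :=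
  ∏ i : Fin (N - 1),
    P (x (⟨i.1, by have := i.isLt; omega⟩, 0), x (⟨i.1 + 1, by have := i.isLt; omega⟩, 0),
       x (⟨i.1, by have := i.isLt; omega⟩, 1), x (⟨i.1 + 1, by have := i.isLt; omega⟩, 1))

/-- Denominator of the snake distribution. -/
noncomputable def snakeDen (P : S × S × S × S → ℝ) (N : ℕ) (x : Fin N × Fin 2 → S) : ℝ :=
  ∏ i : Fin (N - 2),
    margAC P (x (⟨i.1 + 1, by have := i.isLt; omega⟩, 0),
              x (⟨i.1 + 1, by have := i.isLt; omega⟩, 1))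

open Classical in
/-- The snake distribution on two-row configurations, with the convention that it vanishes
whenever its numerator vanishes. -/
noncomputable def Snake (P : S × S × S × S → ℝ) (N : ℕ) : (Fin N × Fin 2 → S) → ℝ :=
  fun x => if snakeNum P N x = 0 then 0 else snakeNum P N x / snakeDen P N x

end Ansatz

/-- Summing a product of kernels along a path, when the row sums of the kernel do not depend on the
current position (on the support of the walk). -/
theorem sum_path_eq_sum_mul_prod {S : Type*} [Fintype S] (m : S → S → Prop)
    (k : S → S → S → S → ℝ) (q : S → S → ℝ)
    (hsum : ∀ a c d, m a c → ∑ b, k a b c d = q c d)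
    (hsupp : ∀ a b c d, k a b c d ≠ 0 → m b d) (n : ℕ) (y : Fin (n + 1) → S) (W : S → ℝ)
    (hW : ∀ a, W a ≠ 0 → m a (y 0)) :
    ∑ r : Fin (n + 1) → S,
        W (r 0) * ∏ i : Fin n, k (r i.castSucc) (r i.succ) (y i.castSucc) (y i.succ) =
      (∑ a, W a) * ∏ i : Fin n, q (y i.castSucc) (y i.succ) := by
  induction n generalizing W with
  | zero =>
    simpa using (Equiv.funUnique (Fin 1) S).sum_comp W
  | succ n ih =>
    rw [← (Fin.consEquiv fun _ : Fin (n + 2) => S).sum_comp, Fintype.sum_prod_type,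
      Finset.sum_mul]
    refine Finset.sum_congr rfl fun a _ => ?_
    have key := ih (fun i => y i.succ) (fun b => k a b (y 0) (y 1))
      fun b hb => hsupp a b _ _ hb
    simp only [Fin.consEquiv_apply, Fin.cons_zero, Fin.prod_univ_succ, Fin.castSucc_zero,
      Fin.cons_succ, ← Fin.succ_castSucc, Fin.succ_zero_eq_one, ← Finset.mul_sum] at key ⊢
    by_cases ha : W a = 0
    · simp [ha]
    · rw [← hsum a _ _ (hW a ha)]
      exact congrArg (W a * ·) key

/-- A pointwise form of the Gibbs inequality. -/
theorem sub_le_mul_log_sub_log {p q : ℝ} (hp : 0 < p) (hq : 0 < q) :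
    p - q ≤ p * (Real.log p - Real.log q) := by
  have h := Real.log_le_sub_one_of_pos (div_pos hq hp)
  rw [Real.log_div hq.ne' hp.ne'] at h
  have h' := mul_le_mul_of_nonneg_left h hp.le
  rw [mul_sub, mul_sub, mul_div_cancel₀ _ hp.ne'] at h'
  linarith

/-- The equality case of `sub_le_mul_log_sub_log`. -/
theorem eq_of_sub_eq_mul_log_sub_log {p q : ℝ} (hp : 0 < p) (hq : 0 < q)
    (h : p * (Real.log p - Real.log q) = p - q) : p = q := by
  by_contra hne
  have h1 : q / p ≠ 1 := fun h1 => hne ((div_eq_one_iff_eq hp.ne').1 h1).symm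
  have h2 := Real.log_lt_sub_one_of_pos (div_pos hq hp) h1
  rw [Real.log_div hq.ne' hp.ne'] at h2
  have h' := mul_lt_mul_of_pos_left h2 hp
  rw [mul_sub, mul_sub, mul_div_cancel₀ _ hp.ne'] at h'
  linarith

/-- Equality in strong subadditivity of the Shannon entropy forces conditional independence. -/
theorem mul_eq_mul_of_entropy_eq {α β γ : Type*} [Fintype α] [Fintype β] [Fintype γ]
    (R : α → β → γ → ℝ) (hR : ∀ a c d, 0 ≤ R a c d)
    (X : α → β → ℝ) (Y : β → γ → ℝ) (Z : β → ℝ)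
    (hX : ∀ a c, X a c = ∑ d, R a c d) (hY : ∀ c d, Y c d = ∑ a, R a c d)
    (hZX : ∀ c, Z c = ∑ a, X a c) (hZY : ∀ c, Z c = ∑ d, Y c d)
    (hH : ∑ a, ∑ c, X a c * Real.log (X a c) + ∑ c, ∑ d, Y c d * Real.log (Y c d)
      = ∑ c, Z c * Real.log (Z c) + ∑ a, ∑ c, ∑ d, R a c d * Real.log (R a c d))
    (a : α) (c : β) (d : γ) : R a c d * Z c = X a c * Y c d := by
  have hRX : ∀ a c d, R a c d ≤ X a c := fun a c d => by
    rw [hX]; exact Finset.single_le_sum (fun d _ => hR a c d) (Finset.mem_univ d)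
  have hRY : ∀ a c d, R a c d ≤ Y c d := fun a c d => by
    rw [hY]; exact Finset.single_le_sum (fun a _ => hR a c d) (Finset.mem_univ a)
  have hX0 : ∀ a c, 0 ≤ X a c := fun a c => by
    rw [hX]; exact Finset.sum_nonneg fun d _ => hR a c d
  have hY0 : ∀ c d, 0 ≤ Y c d := fun c d => by
    rw [hY]; exact Finset.sum_nonneg fun a _ => hR a c d
  have hXZ : ∀ a c, X a c ≤ Z c := fun a c => by
    rw [hZX]; exact Finset.single_le_sum (fun a _ => hX0 a c) (Finset.mem_univ a)
  have hZ0 : ∀ c, 0 ≤ Z c := fun c => by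
    rw [hZX]; exact Finset.sum_nonneg fun a _ => hX0 a c
  have hpos : ∀ a c d, R a c d ≠ 0 →
      0 < R a c d ∧ 0 < X a c ∧ 0 < Y c d ∧ 0 < Z c := fun a c d h => by
    have h0 := (hR a c d).lt_of_ne' h
    have h1 := h0.trans_le (hRX a c d)
    exact ⟨h0, h1, h0.trans_le (hRY a c d), h1.trans_le (hXZ a c)⟩
  have hlog : ∀ a c d, R a c d ≠ 0 → Real.log (X a c * Y c d / Z c)
      = Real.log (X a c) + Real.log (Y c d) - Real.log (Z c) := fun a c d h => by
    obtain ⟨-, h1, h2, h3⟩ := hpos a c d h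
    rw [Real.log_div (mul_pos h1 h2).ne' h3.ne', Real.log_mul h1.ne' h2.ne']
  set G : α → β → γ → ℝ := fun a c d =>
    R a c d * (Real.log (R a c d) + Real.log (Z c) - Real.log (X a c) - Real.log (Y c d))
      - (R a c d - X a c * Y c d / Z c) with hG
  have hG0 : ∀ a c d, 0 ≤ G a c d := fun a c d => by
    by_cases h : R a c d = 0
    · simpa [hG, h] using div_nonneg (mul_nonneg (hX0 a c) (hY0 c d)) (hZ0 c)
    · obtain ⟨h0, h1, h2, h3⟩ := hpos a c d h
      have := sub_le_mul_log_sub_log h0 (div_pos (mul_pos h1 h2) h3)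
      rw [hlog a c d h] at this
      simp only [hG]
      linarith
  have sR : ∑ a, ∑ c, ∑ d, R a c d = ∑ c, Z c := by
    rw [Finset.sum_comm]
    simp only [hZX, hX]
  have sQ : ∑ a, ∑ c, ∑ d, X a c * Y c d / Z c = ∑ c, Z c := by
    rw [Finset.sum_comm]
    refine Finset.sum_congr rfl fun c _ => ?_
    simp only [← Finset.sum_div, ← Finset.mul_sum, ← Finset.sum_mul, ← hZX, ← hZY]
    exact mul_self_div_self _
  have sX : ∑ a, ∑ c, ∑ d, R a c d * Real.log (X a c)
      = ∑ a, ∑ c, X a c * Real.log (X a c) := by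
    simp only [← Finset.sum_mul, ← hX]
  have sY : ∑ a, ∑ c, ∑ d, R a c d * Real.log (Y c d)
      = ∑ c, ∑ d, Y c d * Real.log (Y c d) := by
    rw [Finset.sum_comm]
    refine Finset.sum_congr rfl fun c _ => ?_
    rw [Finset.sum_comm]
    simp only [← Finset.sum_mul, ← hY]
  have sZ : ∑ a, ∑ c, ∑ d, R a c d * Real.log (Z c) = ∑ c, Z c * Real.log (Z c) := by
    rw [Finset.sum_comm]
    simp only [← Finset.sum_mul, ← hX, ← hZX]
  have sG : ∑ a, ∑ c, ∑ d, G a c d = 0 := by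
    simp only [hG, mul_sub, mul_add, Finset.sum_sub_distrib, Finset.sum_add_distrib, sR, sQ, sX,
      sY, sZ]
    linarith
  have hGz : G a c d = 0 := by
    have h1 := (Finset.sum_eq_zero_iff_of_nonneg fun a _ => Finset.sum_nonneg fun c _ =>
      Finset.sum_nonneg fun d _ => hG0 a c d).1 sG a (Finset.mem_univ a)
    have h2 := (Finset.sum_eq_zero_iff_of_nonneg fun c _ =>
      Finset.sum_nonneg fun d _ => hG0 a c d).1 h1 c (Finset.mem_univ c)
    exact (Finset.sum_eq_zero_iff_of_nonneg fun d _ => hG0 a c d).1 h2 d (Finset.mem_univ d)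
  by_cases h : R a c d = 0
  · have h' : X a c * Y c d / Z c = 0 := by simpa [hG, h] using hGz
    rw [h, zero_mul]
    rcases div_eq_zero_iff.1 h' with h' | h'
    · exact h'.symm
    · rw [le_antisymm (h' ▸ hXZ a c) (hX0 a c), zero_mul]
  · obtain ⟨h0, h1, h2, h3⟩ := hpos a c d h
    refine (eq_div_iff h3.ne').1
      (eq_of_sub_eq_mul_log_sub_log h0 (div_pos (mul_pos h1 h2) h3) ?_)
    rw [hlog a c d h]
    simp only [hG] at hGz
    linarith

section MarginalRelations

variable {S : Type*} [Fintype S] {P : S × S × S × S → ℝ}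

theorem margA_eq_sum_margAB (c : S) : margA P c = ∑ d, margAB P (c, d) := rfl

theorem margAC_eq_sum_margACD (a c : S) : margAC P (a, c) = ∑ d, margACD P (a, c, d) :=
  Finset.sum_comm

theorem CL.margAB_eq_sum_margACD (hCL : CL P) (c d : S) :
    margAB P (c, d) = ∑ a, margACD P (a, c, d) := by
  rw [hCL.1]; rfl

theorem CL.margA_eq_sum_margAC (hCL : CL P) (c : S) : margA P c = ∑ a, margAC P (a, c) := by
  simp only [margA_eq_sum_margAB, hCL.margAB_eq_sum_margACD, margAC_eq_sum_margACD]
  exact Finset.sum_comm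

/-- Under the constraints, the sites `a` and `d` are conditionally independent given `c`. -/
theorem margACD_mul_margA (hP : ∀ x, 0 ≤ P x) (hCL : CL P) (hCM : CM P) (a c d : S) :
    margACD P (a, c, d) * margA P c = margAC P (a, c) * margAB P (c, d) := by
  refine mul_eq_mul_of_entropy_eq (fun a c d => margACD P (a, c, d))
    (fun a c d => Finset.sum_nonneg fun _ _ => hP _) (fun a c => margAC P (a, c))
    (fun c d => margAB P (c, d)) (margA P) margAC_eq_sum_margACD hCL.margAB_eq_sum_margACD
    hCL.margA_eq_sum_margAC margA_eq_sum_margAB ?_ a c d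
  have h := hCM.2
  simp only [entropy, Fintype.sum_prod_type] at h
  linarith

theorem le_margAC (hP : ∀ x, 0 ≤ P x) (a b c d : S) : P (a, b, c, d) ≤ margAC P (a, c) :=
  (Finset.single_le_sum (f := fun w => P (a, b, c, w)) (fun _ _ => hP _)
    (Finset.mem_univ d)).trans
    (Finset.single_le_sum (f := fun y => ∑ w, P (a, y, c, w))
      (fun _ _ => Finset.sum_nonneg fun _ _ => hP _) (Finset.mem_univ b))

theorem le_margBD (hP : ∀ x, 0 ≤ P x) (a b c d : S) : P (a, b, c, d) ≤ margBD P (b, d) :=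
  (Finset.single_le_sum (f := fun z => P (a, b, z, d)) (fun _ _ => hP _)
    (Finset.mem_univ c)).trans
    (Finset.single_le_sum (f := fun x => ∑ z, P (x, b, z, d))
      (fun _ _ => Finset.sum_nonneg fun _ _ => hP _) (Finset.mem_univ a))

theorem margAB_nonneg (hP : ∀ x, 0 ≤ P x) (p : S × S) : 0 ≤ margAB P p :=
  Finset.sum_nonneg fun _ _ => Finset.sum_nonneg fun _ _ => hP _

theorem margAC_nonneg (hP : ∀ x, 0 ≤ P x) (p : S × S) : 0 ≤ margAC P p :=
  Finset.sum_nonneg fun _ _ => Finset.sum_nonneg fun _ _ => hP _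

theorem margAB_le_margA (hP : ∀ x, 0 ≤ P x) (c d : S) : margAB P (c, d) ≤ margA P c :=
  Finset.single_le_sum (f := fun d => margAB P (c, d)) (fun _ _ => margAB_nonneg hP _)
    (Finset.mem_univ d)

theorem CL.margAC_le_margA (hP : ∀ x, 0 ≤ P x) (hCL : CL P) (a c : S) :
    margAC P (a, c) ≤ margA P c := by
  rw [hCL.margA_eq_sum_margAC]
  exact Finset.single_le_sum (f := fun a => margAC P (a, c)) (fun _ _ => margAC_nonneg hP _)
    (Finset.mem_univ a)

end MarginalRelations

/-- Absorbing the initial weight into a product of normalized steps. -/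
theorem mul_prod_div_eq_prod_div_prod {n : ℕ} (f g : Fin (n + 1) → ℝ) (h : g 0 = 0 → f 0 = 0) :
    g 0 * ∏ i, f i / g i = (∏ i, f i) / ∏ i : Fin n, g i.succ := by
  rw [Finset.prod_div_distrib, Fin.prod_univ_succ g]
  by_cases h0 : g 0 = 0
  · simp [h0, Fin.prod_univ_succ f, h h0]
  · rw [← mul_div_assoc, mul_div_mul_left _ _ h0]

open Classical in
/-- snake lemma, Lemma 1 of the paper: summing the snake distribution
over the first-row variables yields the Markov-chain expression
`∏ᵢ P_ab(x(i,2), x(i+1,2)) / ∏ᵢ P_a(x(i,2))` in the second-row variables `y`. -/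
theorem snake_sum_first_row
    {S : Type*} [Fintype S] [DecidableEq S] [Nonempty S]
    (P : S × S × S × S → ℝ) (hP : IsProbDist P) (hCL : CL P) (hCM : CM P)
    (N : ℕ) (hN : 2 ≤ N) (y : Fin N → S) :
    (∑ r : Fin N → S, Snake P N (fun p => if p.2 = 0 then r p.1 else y p.1)) =
      if (∏ i : Fin (N - 1),
            margAB P (y ⟨i.1, by have := i.isLt; omega⟩,
                      y ⟨i.1 + 1, by have := i.isLt; omega⟩)) = 0 then 0
      else
        (∏ i : Fin (N - 1),
          margAB P (y ⟨i.1, by have := i.isLt; omega⟩,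
                    y ⟨i.1 + 1, by have := i.isLt; omega⟩)) /
        ∏ i : Fin (N - 2), margA P (y ⟨i.1 + 1, by have := i.isLt; omega⟩) := by
  obtain ⟨n, rfl⟩ : ∃ n, N = n + 2 := ⟨N - 2, by omega⟩
  have hP0 := hP.1
  have hif : ∀ u v : ℝ, (if u = 0 then 0 else u / v) = u / v := fun u v => by
    split_ifs with h <;> simp [h]
  have hsnake : ∀ r : Fin (n + 2) → S,
      Snake P (n + 2) (fun p => if p.2 = 0 then r p.1 else y p.1) =
        margAC P (r 0, y 0) * ∏ i : Fin (n + 1),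
          P (r i.castSucc, r i.succ, y i.castSucc, y i.succ) /
            margAC P (r i.castSucc, y i.castSucc) := fun r =>
    (hif _ _).trans (mul_prod_div_eq_prod_div_prod
      (fun i : Fin (n + 1) => P (r i.castSucc, r i.succ, y i.castSucc, y i.succ))
      (fun i => margAC P (r i.castSucc, y i.castSucc))
      fun h => le_antisymm (h ▸ le_margAC hP0 _ _ _ _) (hP0 _)).symm
  rw [hif, Finset.sum_congr rfl fun r _ => hsnake r]
  have hsum : ∀ a c d, margAC P (a, c) ≠ 0 →
      ∑ b, P (a, b, c, d) / margAC P (a, c) = margAB P (c, d) / margA P c := fun a c d h => by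
    have hc : margA P c ≠ 0 :=
      (((margAC_nonneg hP0 _).lt_of_ne' h).trans_le (hCL.margAC_le_margA hP0 a c)).ne'
    rw [← Finset.sum_div, div_eq_div_iff h hc, mul_comm (margAB P (c, d))]
    exact margACD_mul_margA hP0 hCL hCM a c d
  have hsupp : ∀ a b c d, P (a, b, c, d) / margAC P (a, c) ≠ 0 → margAC P (b, d) ≠ 0 :=
    fun a b c d h => by
      rw [hCL.2]
      exact (((hP0 _).lt_of_ne' (div_ne_zero_iff.1 h).1).trans_le (le_margBD hP0 a b c d)).ne'
  rw [sum_path_eq_sum_mul_prod (fun a c => margAC P (a, c) ≠ 0)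
    (fun a b c d => P (a, b, c, d) / margAC P (a, c))
    (fun c d => margAB P (c, d) / margA P c) hsum hsupp (n + 1) y
    (fun a => margAC P (a, y 0)) fun _ h => h, ← hCL.margA_eq_sum_margAC]
  exact mul_prod_div_eq_prod_div_prod
    (fun i : Fin (n + 1) => margAB P (y i.castSucc, y i.succ)) (fun i => margA P (y i.castSucc))
    fun h => le_antisymm (h ▸ margAB_le_margA hP0 _ _) (margAB_nonneg hP0 _)
end

section
/- Let S be a nonempty finite set, let P be a probability distribution on S^4 satisfying the constraints C_L and C_M, and let N ≥ 3 and M ≥ 4 be integers. Then for every configuration ω : {1,…,N}×{1,…,M} → S, Q_{N,M}(ω) = Q_{N,M−1}(ω restricted to rows 2,…,M, re-indexed as rows 1,…,M−1) · Snake_N(ω restricted to rows 1,2) / [∏_{i=1}^{N−1} P_{ab}(ω(i,2), ω(i+1,2)) / ∏_{i=2}^{N−1} P_a(ω(i,2))], where each quotient is interpreted with the convention that it is 0 whenever its numerator vanishes, and the identity is asserted whenever Q_{N,M}(ω) ≠ 0 or the right-hand side is well-defined as 0. -/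
open Finset

section Factorization

variable {S : Type*} [Fintype S]

theorem QNM_eq_div (P : S × S × S × S → ℝ) (N M : ℕ) (ω : Fin N × Fin M → S) :
    QNM P N M ω = QNMnum P N M ω / QNMden P N M ω := by
  unfold QNM
  split_ifs with h <;> simp [h]

theorem Snake_eq_div (P : S × S × S × S → ℝ) (N : ℕ) (x : Fin N × Fin 2 → S) :
    Snake P N x = snakeNum P N x / snakeDen P N x := by
  unfold Snake
  split_ifs with h <;> simp [h]

/-- Splitting the bottom row of clusters off the numerator. -/
theorem QNMnum_succ (P : S × S × S × S → ℝ) (N K : ℕ) (ω : Fin N × Fin (K + 3) → S) :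
    QNMnum P N (K + 3) ω =
      QNMnum P N (K + 2) (fun p => ω (p.1, p.2.succ)) *
        snakeNum P N (fun p => ω (p.1, p.2.castLE (by omega))) *
        ∏ i : Fin (N - 2), margA P (ω (⟨i.1 + 1, by omega⟩, 1)) := by
  have h1 (i : Fin (N - 1)) := Fin.prod_univ_succ (n := K + 1) fun j => P (cluster ω i j)
  have h2 (i : Fin (N - 2)) := Fin.prod_univ_succ (n := K) fun j =>
    margA P (ω (⟨i.1 + 1, by omega⟩, ⟨j.1 + 1, by omega⟩))
  simp only [QNMnum, snakeNum] at h1 h2 ⊢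
  erw [Finset.prod_congr rfl fun i _ => h1 i, Finset.prod_congr rfl fun i _ => h2 i]
  rw [Finset.prod_mul_distrib, Finset.prod_mul_distrib]
  exact (by intros; ring : ∀ a b c d : ℝ, a * b * (c * d) = b * d * a * c) _ _ _ _

/-- Splitting the bottom row of clusters off the denominator. -/
theorem QNMden_succ (P : S × S × S × S → ℝ) (N K : ℕ) (ω : Fin N × Fin (K + 3) → S) :
    QNMden P N (K + 3) ω =
      QNMden P N (K + 2) (fun p => ω (p.1, p.2.succ)) *
        snakeDen P N (fun p => ω (p.1, p.2.castLE (by omega))) *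
        ∏ i : Fin (N - 1), margAB P (ω (⟨i.1, by omega⟩, 1), ω (⟨i.1 + 1, by omega⟩, 1)) := by
  have h1 (i : Fin (N - 2)) := Fin.prod_univ_succ (n := K + 1) fun j =>
    margAC P (ω (⟨i.1 + 1, by omega⟩, ⟨j.1, by omega⟩),
      ω (⟨i.1 + 1, by omega⟩, ⟨j.1 + 1, by omega⟩))
  have h2 (i : Fin (N - 1)) := Fin.prod_univ_succ (n := K) fun j =>
    margAB P (ω (⟨i.1, by omega⟩, ⟨j.1 + 1, by omega⟩),
      ω (⟨i.1 + 1, by omega⟩, ⟨j.1 + 1, by omega⟩))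
  simp only [QNMden, snakeDen] at h1 h2 ⊢
  erw [Finset.prod_congr rfl fun i _ => h1 i, Finset.prod_congr rfl fun i _ => h2 i]
  rw [Finset.prod_mul_distrib, Finset.prod_mul_distrib]
  exact (by intros; ring : ∀ a b c d : ℝ, a * b * (c * d) = b * d * a * c) _ _ _ _

end Factorization

open Classical in
/-- Proposition 1 of the paper: `Q_{N,M}` factorizes as `Q_{N,M−1}` on
rows `2,…,M` times the snake on rows `1,2` divided by the Markov-chain expression
`∏ᵢ P_ab(ω(i,2), ω(i+1,2)) / ∏ᵢ P_a(ω(i,2))`, the identity being asserted whenever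
`Q_{N,M}(ω) ≠ 0` or the right-hand side is (well-defined and) equal to `0`. -/
theorem QNM_factorization
    {S : Type*} [Fintype S] [DecidableEq S] [Nonempty S]
    (P : S × S × S × S → ℝ) (hP : IsProbDist P) (hCL : CL P) (hCM : CM P)
    (N M : ℕ) (hN : 3 ≤ N) (hM : 4 ≤ M) (ω : Fin N × Fin M → S) :
    -- rows `2, …, M` of `ω`, re-indexed as rows `1, …, M−1`
    let ωtop : Fin N × Fin (M - 1) → S :=
      fun p => ω (p.1, ⟨p.2.1 + 1, by have := p.2.isLt; omega⟩)
    -- rows `1, 2` of `ω`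
    let ωbot : Fin N × Fin 2 → S :=
      fun p => ω (p.1, ⟨p.2.1, by have := p.2.isLt; omega⟩)
    -- the Markov-chain quotient on row `2`, with the 0-convention
    let q : ℝ :=
      if (∏ i : Fin (N - 1),
            margAB P (ω (⟨i.1, by have := i.isLt; omega⟩, ⟨1, by omega⟩),
                      ω (⟨i.1 + 1, by have := i.isLt; omega⟩, ⟨1, by omega⟩))) = 0 then 0
      else
        (∏ i : Fin (N - 1),
          margAB P (ω (⟨i.1, by have := i.isLt; omega⟩, ⟨1, by omega⟩),
                    ω (⟨i.1 + 1, by have := i.isLt; omega⟩, ⟨1, by omega⟩))) /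
        ∏ i : Fin (N - 2), margA P (ω (⟨i.1 + 1, by have := i.isLt; omega⟩, ⟨1, by omega⟩))
    QNM P N M ω ≠ 0 ∨ QNM P N (M - 1) ωtop * Snake P N ωbot / q = 0 →
      QNM P N M ω = QNM P N (M - 1) ωtop * Snake P N ωbot / q := by
  intro ωtop ωbot q _
  obtain ⟨K, rfl⟩ : ∃ K, M = K + 3 := ⟨M - 3, by omega⟩
  have hq : q =
      (∏ i : Fin (N - 1), margAB P (ω (⟨i.1, by omega⟩, 1), ω (⟨i.1 + 1, by omega⟩, 1))) /
        ∏ i : Fin (N - 2), margA P (ω (⟨i.1 + 1, by omega⟩, 1)) := by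
    unfold q
    split_ifs with h
    · exact (div_eq_zero_iff.2 (Or.inl h)).symm
    · rfl
  rw [hq, QNM_eq_div, QNM_eq_div, Snake_eq_div, QNMnum_succ, QNMden_succ, div_mul_div_comm,
    div_div_div_eq]
  rfl
end

section
/- Let S be a nonempty finite set, let P be a probability distribution on S^4 satisfying the constraints C_L and C_M, and let N ≥ 2 be an integer. Then the snake Snake_N is a probability distribution on configurations x : {1,…,N}×{1,2} → S (it is nonnegative and sums to 1), and it is consistent with P: for every 1 ≤ i ≤ N−1, the pushforward of Snake_N under x ↦ (x(i,1), x(i+1,1), x(i,2), x(i+1,2)) equals P. -/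
open Finset

section MarkovPath

variable {T : Type*}

/-- The weight of a path of length `n + 2` in the Markov chain with pair distribution `w` and
stationary distribution `μ`. -/
noncomputable def pathWeight (w : T → T → ℝ) (μ : T → ℝ) (n : ℕ) (y : Fin (n + 2) → T) : ℝ :=
  (∏ i : Fin (n + 1), w (y i.castSucc) (y i.succ)) / ∏ i : Fin n, μ (y i.castSucc.succ)

theorem pathWeight_cons (w : T → T → ℝ) (μ : T → ℝ) (n : ℕ) (a : T) (y : Fin (n + 2) → T) :
    pathWeight w μ (n + 1) (Fin.cons a y : Fin (n + 3) → T) =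
      w a (y 0) / μ (y 0) * pathWeight w μ n y := by
  unfold pathWeight
  rw [Fin.prod_univ_succ (n := n + 1), Fin.prod_univ_succ (n := n) (M := ℝ)
    (f := fun i => μ ((Fin.cons a y : Fin (n + 3) → T) i.castSucc.succ)), mul_div_mul_comm]
  rfl

theorem pathWeight_eq_zero {w : T → T → ℝ} {n : ℕ} {y : Fin (n + 2) → T} (μ : T → ℝ)
    (h : ∀ u, w (y 0) u = 0) : pathWeight w μ n y = 0 := by
  have h0 : w (y (Fin.castSucc 0)) (y (Fin.succ 0)) = 0 := h _
  rw [pathWeight, Finset.prod_eq_zero (mem_univ (0 : Fin (n + 1))) h0, zero_div]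

variable [Fintype T] {w : T → T → ℝ} {μ : T → ℝ}

/-- The marginal of the path weight on any two consecutive sites is `w`, phrased with test
functions. -/
theorem sum_mul_pathWeight (hw : ∀ t u, 0 ≤ w t u) (hrow : ∀ t, ∑ u, w t u = μ t)
    (hcol : ∀ u, ∑ t, w t u = μ u) (n : ℕ) (i : Fin (n + 1)) (F : T → T → ℝ) :
    ∑ y : Fin (n + 2) → T, F (y i.castSucc) (y i.succ) * pathWeight w μ n y =
      ∑ t, ∑ u, F t u * w t u := by
  have row_zero : ∀ t u, μ t = 0 → w t u = 0 := fun t u h =>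
    (Finset.sum_eq_zero_iff_of_nonneg fun v _ => hw t v).1 ((hrow t).trans h) u (mem_univ u)
  have col_zero : ∀ t u, μ u = 0 → w t u = 0 := fun t u h =>
    (Finset.sum_eq_zero_iff_of_nonneg fun v _ => hw v u).1 ((hcol u).trans h) t (mem_univ t)
  induction n generalizing F with
  | zero =>
    obtain rfl : i = 0 := Subsingleton.elim (α := Fin 1) _ _
    rw [← (finTwoArrowEquiv T).symm.sum_comp, Fintype.sum_prod_type]
    simp [pathWeight, finTwoArrowEquiv]
  | succ n ih =>
    rw [← (Fin.consEquiv fun _ : Fin (n + 3) => T).sum_comp, Fintype.sum_prod_type,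
      Finset.sum_comm]
    change ∑ y : Fin (n + 2) → T, ∑ a : T, F ((Fin.cons a y : Fin (n + 3) → T) i.castSucc)
      ((Fin.cons a y : Fin (n + 3) → T) i.succ) * pathWeight w μ (n + 1)
        (Fin.cons a y : Fin (n + 3) → T) = _
    simp only [pathWeight_cons]
    cases i using Fin.cases with
    | zero =>
      calc _ = ∑ y : Fin (n + 2) → T,
              (∑ a, F a (y 0) * (w a (y 0) / μ (y 0))) * pathWeight w μ n y := by
            refine Finset.sum_congr rfl fun y _ => ?_
            rw [Finset.sum_mul]
            exact Finset.sum_congr rfl fun a _ => (mul_assoc _ _ _).symm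
        _ = ∑ t, ∑ u, (∑ a, F a t * (w a t / μ t)) * w t u :=
            ih 0 fun t _ => ∑ a, F a t * (w a t / μ t)
        _ = ∑ t, ∑ a, F a t * w a t := by
            refine Finset.sum_congr rfl fun t _ => ?_
            rw [← Finset.mul_sum, hrow, Finset.sum_mul]
            refine Finset.sum_congr rfl fun a _ => ?_
            rw [mul_assoc, div_mul_cancel_of_imp (col_zero a t)]
        _ = _ := Finset.sum_comm
    | succ j =>
      rw [← ih j F]
      refine Finset.sum_congr rfl fun y _ => ?_
      change ∑ a, F (y j.castSucc) (y j.succ) * (w a (y 0) / μ (y 0) * pathWeight w μ n y) = _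
      rw [← Finset.mul_sum, ← Finset.sum_mul, ← Finset.sum_div, hcol]
      by_cases h : μ (y 0) = 0
      · rw [pathWeight_eq_zero μ fun u => row_zero _ u h, mul_zero]
      · rw [div_self h, one_mul]

end MarkovPath

section Snake

variable {S : Type*}

/-- Two-row configurations as paths of columns. -/
def columnsEquiv (S : Type*) (N : ℕ) : (Fin N × Fin 2 → S) ≃ (Fin N → S × S) :=
  (Equiv.curry _ _ _).trans ((Equiv.refl _).arrowCongr (finTwoArrowEquiv S))

variable [Fintype S]

theorem snake_eq_pathWeight (P : S × S × S × S → ℝ) (n : ℕ) (x : Fin (n + 2) × Fin 2 → S) :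
    Snake P (n + 2) x =
      pathWeight (fun t u => P (t.1, u.1, t.2, u.2)) (margAC P) n (columnsEquiv S (n + 2) x) := by
  have h : Snake P (n + 2) x = snakeNum P (n + 2) x / snakeDen P (n + 2) x := by
    unfold Snake
    split_ifs with h
    · rw [h, zero_div]
    · rfl
  exact h

theorem snake_nonneg {P : S × S × S × S → ℝ} (hP : ∀ p, 0 ≤ P p) (N : ℕ)
    (x : Fin N × Fin 2 → S) : 0 ≤ Snake P N x := by
  unfold Snake
  split_ifs
  · exact le_rfl
  · exact div_nonneg (Finset.prod_nonneg fun _ _ => hP _) (Finset.prod_nonneg fun _ _ =>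
      Finset.sum_nonneg fun _ _ => Finset.sum_nonneg fun _ _ => hP _)

theorem snake_consistent [DecidableEq S] {P : S × S × S × S → ℝ} (hP : ∀ p, 0 ≤ P p)
    (hAC : margAC P = margBD P) (n : ℕ) : Consistent (Snake P (n + 2)) P := by
  intro i j
  obtain rfl : j = 0 := Subsingleton.elim (α := Fin 1) _ _
  funext p
  have key := sum_mul_pathWeight (w := fun t u : S × S => P (t.1, u.1, t.2, u.2))
    (μ := margAC P) (fun _ _ => hP _) (fun t => Fintype.sum_prod_type _)
    (fun u => by rw [hAC]; exact Fintype.sum_prod_type _) n i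
    fun t u => if (t.1, u.1, t.2, u.2) = p then 1 else 0
  rw [← (columnsEquiv S (n + 2)).sum_comp] at key
  simp only [← snake_eq_pathWeight, ite_mul, one_mul, zero_mul] at key
  refine key.trans ?_
  obtain ⟨a, b, c, d⟩ := p
  rw [Finset.sum_eq_single (a, c), Finset.sum_eq_single (b, d)]
  · simp
  · rintro ⟨b', d'⟩ - h
    exact if_neg fun h' => h (by simp_all)
  · simp
  · rintro ⟨a', c'⟩ - h
    exact Finset.sum_eq_zero fun u _ => if_neg fun h' => h (by simp_all)
  · simp

end Snake

theorem sum_marginalAt {S : Type*} [Fintype S] [DecidableEq S] {N M : ℕ}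
    (Q : (Fin N × Fin M → S) → ℝ) (i : Fin (N - 1)) (j : Fin (M - 1)) :
    ∑ p, marginalAt Q i j p = ∑ ω, Q ω := by
  unfold marginalAt
  rw [Finset.sum_comm]
  simp


/-- the snake is a probability distribution on two-row configurations and
every 2×2 cluster marginal of it equals `P`. -/
theorem snake_isProbDist_and_consistent
    {S : Type*} [Fintype S] [DecidableEq S] [Nonempty S]
    (P : S × S × S × S → ℝ) (hP : IsProbDist P) (hCL : CL P) (hCM : CM P)
    (N : ℕ) (hN : 2 ≤ N) :
    IsProbDist (Snake P N) ∧ Consistent (Snake P N) P := by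
  obtain ⟨n, rfl⟩ := Nat.exists_eq_add_of_le' hN
  have hcons := snake_consistent hP.1 hCL.2 n
  refine ⟨⟨snake_nonneg hP.1 _, ?_⟩, hcons⟩
  have i₀ : Fin (n + 2 - 1) := (0 : Fin (n + 1))
  rw [← sum_marginalAt _ i₀ (0 : Fin 1), hcons i₀ (0 : Fin 1), hP.2]
end

section
/- Let S be a nonempty finite set, let P be a probability distribution on S^4, let N ≥ 2 be an integer, and let Q be any probability distribution on configurations ω : {1,…,N}×{1,2} → S such that for every 1 ≤ i ≤ N−1 the pushforward of Q under ω ↦ (ω(i,1), ω(i+1,1), ω(i,2), ω(i+1,2)) equals P. Then H(Q) ≤ (N−1)·H(P) − (N−2)·H(P_{ac}). -/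
open Finset

/-- The pushforward of a weight function under a map of finite types. -/
def pushWeight {α β : Type*} [Fintype α] [DecidableEq β] (f : α → β) (Q : α → ℝ) : β → ℝ :=
  fun y => ∑ x, if f x = y then Q x else 0

section PushWeight

variable {α β γ δ : Type*} [Fintype α] [DecidableEq β] [DecidableEq γ] [DecidableEq δ]

lemma sum_pushWeight_mul [Fintype β] (f : α → β) (Q : α → ℝ) (u : β → ℝ) :
    ∑ y, pushWeight f Q y * u y = ∑ x, Q x * u (f x) := by
  simp only [pushWeight, Finset.sum_mul]
  rw [Finset.sum_comm]
  refine Finset.sum_congr rfl fun x _ => ?_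
  simp [ite_mul]

lemma sum_pushWeight [Fintype β] (f : α → β) (Q : α → ℝ) : ∑ y, pushWeight f Q y = ∑ x, Q x := by
  simpa using sum_pushWeight_mul f Q (fun _ => 1)

lemma pushWeight_comp [Fintype β] (f : α → β) (h : β → γ) (Q : α → ℝ) :
    pushWeight h (pushWeight f Q) = pushWeight (h ∘ f) Q := by
  funext z
  simpa [pushWeight, mul_ite] using sum_pushWeight_mul f Q (fun y => if h y = z then 1 else 0)

lemma entropy_pushWeight [Fintype β] (f : α → β) (Q : α → ℝ) :
    entropy (pushWeight f Q) = -∑ x, Q x * Real.log (pushWeight f Q (f x)) := by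
  rw [entropy, sum_pushWeight_mul f Q (fun y => Real.log (pushWeight f Q y))]

lemma pushWeight_id [DecidableEq α] (Q : α → ℝ) : pushWeight (fun x => x) Q = Q := by
  funext y
  simp [pushWeight]

variable {Q : α → ℝ}

lemma pushWeight_nonneg (hQ : ∀ x, 0 ≤ Q x) (f : α → β) (y : β) : 0 ≤ pushWeight f Q y :=
  Finset.sum_nonneg fun x _ => by split_ifs <;> simp [hQ x]

lemma le_pushWeight (hQ : ∀ x, 0 ≤ Q x) (f : α → β) (x : α) : Q x ≤ pushWeight f Q (f x) := by
  have := Finset.single_le_sum (f := fun x' => if f x' = f x then Q x' else 0)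
    (fun x' _ => by split_ifs <;> simp [hQ x']) (Finset.mem_univ x)
  simpa [pushWeight] using this

/-- Data processing: entropy does not increase when passing to a determined variable. -/
lemma entropy_pushWeight_mono [Fintype β] [Fintype γ] (hQ : ∀ x, 0 ≤ Q x) (r : α → γ) (f : α → β)
    (hr : ∀ x x', f x = f x' → r x = r x') :
    entropy (pushWeight r Q) ≤ entropy (pushWeight f Q) := by
  rw [entropy_pushWeight, entropy_pushWeight, neg_le_neg_iff]
  refine Finset.sum_le_sum fun x _ => ?_
  rcases (hQ x).eq_or_lt with h | h
  · simp [← h]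
  refine mul_le_mul_of_nonneg_left (Real.log_le_log (h.trans_le (le_pushWeight hQ f x)) ?_) h.le
  refine Finset.sum_le_sum fun x' _ => ?_
  by_cases hf : f x' = f x
  · simp [hf, hr _ _ hf]
  · simp only [hf, if_false]
    split_ifs <;> simp [hQ x']

/-- Submodularity of entropy: two variables `f`, `g` sharing a common part `h ∘ f = h' ∘ g`. -/
lemma entropy_pushWeight_pair_add_le [Fintype β] [Fintype γ] [Fintype δ]
    (hQ : IsProbDist Q) (f : α → β) (g : α → γ) (h : β → δ) (h' : γ → δ) (hc : h ∘ f = h' ∘ g) :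
    entropy (pushWeight (fun x => (f x, g x)) Q) + entropy (pushWeight (h ∘ f) Q)
      ≤ entropy (pushWeight f Q) + entropy (pushWeight g Q) := by
  obtain ⟨hQ0, hQ1⟩ := hQ
  set J := pushWeight (fun x => (f x, g x)) Q with hJ
  set C := pushWeight (h ∘ f) Q with hC
  set F := pushWeight f Q with hF
  set G := pushWeight g Q with hG
  have hF0 : ∀ a, 0 ≤ F a := pushWeight_nonneg hQ0 f
  have hG0 : ∀ b, 0 ≤ G b := pushWeight_nonneg hQ0 g
  have hC0 : ∀ c, 0 ≤ C c := pushWeight_nonneg hQ0 _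
  have hCG : C = pushWeight h' G := by rw [hG, pushWeight_comp, ← hc]
  have hpoint : ∀ x, Q x * Real.log (F (f x)) + Q x * Real.log (G (g x))
      - Q x * Real.log (J (f x, g x)) - Q x * Real.log (C (h (f x)))
      ≤ Q x * (F (f x) * G (g x) / (C (h (f x)) * J (f x, g x))) - Q x := by
    intro x
    rcases (hQ0 x).eq_or_lt with hx | hx
    · simp [← hx]
    have h1 : 0 < F (f x) := hx.trans_le (le_pushWeight hQ0 f x)
    have h2 : 0 < G (g x) := hx.trans_le (le_pushWeight hQ0 g x)
    have h3 : 0 < C (h (f x)) := hx.trans_le (le_pushWeight hQ0 (h ∘ f) x)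
    have h4 : 0 < J (f x, g x) := hx.trans_le (le_pushWeight hQ0 (fun x => (f x, g x)) x)
    have hlog := Real.log_le_sub_one_of_pos (div_pos (mul_pos h1 h2) (mul_pos h3 h4))
    rw [Real.log_div (by positivity) (by positivity), Real.log_mul h1.ne' h2.ne',
      Real.log_mul h3.ne' h4.ne'] at hlog
    nlinarith [mul_le_mul_of_nonneg_left hlog hx.le]
  have hsum := Finset.sum_le_sum fun x (_ : x ∈ Finset.univ) => hpoint x
  have hbound : ∑ x, Q x * (F (f x) * G (g x) / (C (h (f x)) * J (f x, g x))) ≤ 1 := by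
    rw [← sum_pushWeight_mul (fun x => (f x, g x)) Q
      (fun p => F p.1 * G p.2 / (C (h p.1) * J p)), ← hJ, Fintype.sum_prod_type]
    calc ∑ a, ∑ b, J (a, b) * (F a * G b / (C (h a) * J (a, b)))
        ≤ ∑ a, ∑ b, F a / C (h a) * (if h' b = h a then G b else 0) := by
          refine Finset.sum_le_sum fun a _ => Finset.sum_le_sum fun b _ => ?_
          have hnn : 0 ≤ F a / C (h a) * (if h' b = h a then G b else 0) :=
            mul_nonneg (div_nonneg (hF0 a) (hC0 _)) (by split_ifs <;> simp [hG0 b])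
          by_cases hJz : J (a, b) = 0
          · simpa [hJz] using hnn
          · have hab : h' b = h a := by
              by_contra hne
              refine hJz (Finset.sum_eq_zero fun x _ => if_neg fun hx => hne ?_)
              obtain ⟨rfl, rfl⟩ := Prod.mk.inj hx
              exact (congrFun hc x).symm
            rw [if_pos hab]
            refine le_of_eq ?_
            by_cases hCz : C (h a) = 0
            · simp [hCz]
            · field_simp
      _ = ∑ a, F a / C (h a) * C (h a) := by
          refine Finset.sum_congr rfl fun a _ => ?_
          rw [← Finset.mul_sum]
          congr 1
          rw [hCG]
          rfl
      _ ≤ ∑ a, F a := by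
          refine Finset.sum_le_sum fun a _ => ?_
          by_cases hCz : C (h a) = 0
          · simpa [hCz] using hF0 a
          · rw [div_mul_cancel₀ _ hCz]
      _ = 1 := by rw [hF, sum_pushWeight, hQ1]
  have e1 := entropy_pushWeight (fun x => (f x, g x)) Q
  have e2 := entropy_pushWeight (h ∘ f) Q
  have e3 := entropy_pushWeight f Q
  have e4 := entropy_pushWeight g Q
  simp only [← hJ, ← hC, ← hF, ← hG, Function.comp_apply] at e1 e2 e3 e4
  simp only [Finset.sum_sub_distrib, Finset.sum_add_distrib, hQ1] at hsum
  linarith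

end PushWeight

section TwoRows

variable {S : Type*}

/-- Forget the columns of a two-row configuration beyond column `k`, filling in `s`. -/
def truncateColumns {N : ℕ} (s : S) (k : ℕ) (ω : Fin N × Fin 2 → S) : Fin N × Fin 2 → S :=
  fun p => if p.1.1 ≤ k then ω p else s

lemma truncateColumns_apply_of_le {N : ℕ} (s : S) {k : ℕ} (ω : Fin N × Fin 2 → S)
    {p : Fin N × Fin 2} (hp : p.1.1 ≤ k) : truncateColumns s k ω p = ω p := if_pos hp

lemma cluster_eq_imp {N : ℕ} {ω ω' : Fin N × Fin 2 → S} {i : Fin (N - 1)}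
    (h : cluster ω i (0 : Fin (2 - 1)) = cluster ω' i (0 : Fin (2 - 1)))
    (p : Fin N × Fin 2) (hp : p.1.1 = i.1 ∨ p.1.1 = i.1 + 1) : ω p = ω' p := by
  simp only [cluster, Prod.mk.injEq] at h
  obtain ⟨h1, h2, h3, h4⟩ := h
  obtain ⟨⟨a, ha⟩, b⟩ := p
  dsimp only at hp
  rcases hp with rfl | rfl <;> fin_cases b
  · exact h1
  · exact h3
  · exact h2
  · exact h4

lemma pushWeight_left_pair [Fintype S] [DecidableEq S] (P : S × S × S × S → ℝ) :
    pushWeight (fun p => (p.1, p.2.2.1)) P = margAC P := by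
  funext ⟨a, c⟩
  simp only [pushWeight, margAC, Fintype.sum_prod_type, Prod.mk.injEq, ite_and,
    Finset.sum_ite_irrel, Finset.sum_const_zero, Finset.sum_ite_eq', Finset.mem_univ, if_true]
  refine Finset.sum_congr rfl fun y _ => ?_
  rw [Finset.sum_comm]
  simp

lemma entropy_truncateColumns_le [Fintype S] [DecidableEq S] (s : S)
    {P : S × S × S × S → ℝ} {N : ℕ} {Q : (Fin N × Fin 2 → S) → ℝ}
    (hQ : IsProbDist Q) (hQP : Consistent Q P) (k : ℕ) (hk : k + 2 ≤ N) :
    entropy (pushWeight (truncateColumns s (k + 1)) Q)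
      ≤ ((k : ℝ) + 1) * entropy P - k * entropy (margAC P) := by
  have hcl : ∀ i : Fin (N - 1), pushWeight (fun ω => cluster ω i (0 : Fin (2 - 1))) Q = P :=
    fun i => hQP i 0
  induction k with
  | zero =>
    have h := entropy_pushWeight_mono hQ.1 (truncateColumns s (0 + 1))
      (fun ω => cluster ω (⟨0, by omega⟩ : Fin (N - 1)) (0 : Fin (2 - 1))) fun ω ω' hω => by
        funext p
        unfold truncateColumns
        split_ifs with hp
        · exact cluster_eq_imp hω p (by dsimp only; omega)
        · rfl
    rw [hcl] at h
    simpa using h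
  | succ k ih =>
    have ih := ih (by omega)
    let i : Fin (N - 1) := ⟨k + 1, by omega⟩
    let col : (Fin N × Fin 2 → S) → S × S :=
      fun ω => (ω (⟨k + 1, by omega⟩, 0), ω (⟨k + 1, by omega⟩, 1))
    let left : S × S × S × S → S × S := fun p => (p.1, p.2.2.1)
    have hc : col ∘ truncateColumns s (k + 1) =
        left ∘ fun ω : Fin N × Fin 2 → S => cluster ω i (0 : Fin (2 - 1)) := by
      funext ω
      exact Prod.ext (truncateColumns_apply_of_le s ω (le_refl (k + 1)))
        (truncateColumns_apply_of_le s ω (le_refl (k + 1)))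
    have hsub := entropy_pushWeight_pair_add_le hQ (truncateColumns s (k + 1))
      (fun ω => cluster ω i (0 : Fin (2 - 1))) col left hc
    rw [hc, ← pushWeight_comp, hcl, pushWeight_left_pair] at hsub
    have hmono := entropy_pushWeight_mono hQ.1 (truncateColumns s (k + 1 + 1))
      (fun ω => (truncateColumns s (k + 1) ω, cluster ω i (0 : Fin (2 - 1)))) fun ω ω' hω => by
        obtain ⟨h1, h2⟩ := Prod.mk.inj hω
        funext p
        by_cases hp : p.1.1 ≤ k + 1
        · have hp' := congrFun h1 p
          rw [truncateColumns_apply_of_le s _ hp, truncateColumns_apply_of_le s _ hp] at hp'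
          simp [truncateColumns, hp']
        · unfold truncateColumns
          split_ifs with hp2
          · exact cluster_eq_imp h2 p (Or.inr (by dsimp only [i]; omega))
          · rfl
    push_cast
    linarith

end TwoRows

/-- Eq. (30) of the paper: any probability distribution on two-row
configurations all of whose 2×2 cluster marginals equal `P` has entropy at most
`(N−1)·H(P) − (N−2)·H(P_ac)`. No constraints on `P` beyond being consistent marginals
are needed. -/
theorem entropy_two_rows_le
    {S : Type*} [Fintype S] [DecidableEq S] [Nonempty S]
    (P : S × S × S × S → ℝ) (hP : IsProbDist P)
    (N : ℕ) (hN : 2 ≤ N)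
    (Q : (Fin N × Fin 2 → S) → ℝ) (hQ : IsProbDist Q) (hQP : Consistent Q P) :
    entropy Q ≤ ((N : ℝ) - 1) * entropy P - ((N : ℝ) - 2) * entropy (margAC P) := by
  obtain ⟨s⟩ := ‹Nonempty S›
  obtain ⟨k, rfl⟩ : ∃ k, N = k + 2 := ⟨N - 2, by omega⟩
  have h := entropy_truncateColumns_le s hQ hQP k le_rfl
  have hid : truncateColumns s (k + 1) = fun ω : Fin (k + 2) × Fin 2 → S => ω := by
    funext ω p
    exact truncateColumns_apply_of_le s ω (by have := p.1.isLt; omega)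
  rw [hid, pushWeight_id] at h
  push_cast
  linarith
end

section
/- Let S be a nonempty finite set, let P be a probability distribution on S^4 satisfying the constraints C_L and C_M, let N ≥ 2 and k ≥ 2 be integers, and let Q be any probability distribution on configurations ω : {1,…,N}×{1,…,k+1} → S that is consistent with P (every 2×2 cluster marginal of Q equals P). Let Q' denote the marginal of Q on the first k rows. Then H(Q) ≤ H(Q') + (N−1)·H(P) − (N−2)·H(P_{abd}) − H(P_{ab}). -/
open Finset

section Law

variable {Ω α β γ : Type*} [Fintype Ω]

/-- The pushforward of the weights `Q` under `f`. -/
def law [DecidableEq α] (Q : Ω → ℝ) (f : Ω → α) : α → ℝ :=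
  fun a => ∑ ω, if f ω = a then Q ω else 0

lemma law_nonneg [DecidableEq α] {Q : Ω → ℝ} (hQ : ∀ ω, 0 ≤ Q ω) (f : Ω → α) (a : α) :
    0 ≤ law Q f a :=
  Finset.sum_nonneg fun ω _ => by split_ifs <;> simp [hQ ω]

lemma le_law_apply [DecidableEq α] {Q : Ω → ℝ} (hQ : ∀ ω, 0 ≤ Q ω) (f : Ω → α) (ω : Ω) :
    Q ω ≤ law Q f (f ω) := by
  have h := Finset.single_le_sum (s := Finset.univ)
    (f := fun ω' => if f ω' = f ω then Q ω' else 0)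
    (fun ω' _ => by split_ifs <;> simp [hQ ω']) (Finset.mem_univ ω)
  simpa [law] using h

lemma sum_law_prod [Fintype α] [DecidableEq α] [DecidableEq γ] (Q : Ω → ℝ)
    (f : Ω → α) (h : Ω → γ) (c : γ) :
    ∑ a, law Q (fun ω => (f ω, h ω)) (a, c) = law Q h c := by
  simp only [law, Prod.mk.injEq]
  rw [Finset.sum_comm]
  refine Finset.sum_congr rfl fun ω _ => ?_
  by_cases hc : h ω = c <;> simp [hc]

variable [Fintype α] [DecidableEq α] [Fintype β] [DecidableEq β] [Fintype γ] [DecidableEq γ]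

lemma sum_law_mul (Q : Ω → ℝ) (f : Ω → α) (F : α → ℝ) :
    ∑ a, law Q f a * F a = ∑ ω, Q ω * F (f ω) := by
  simp only [law, Finset.sum_mul]
  rw [Finset.sum_comm]
  simp [ite_mul]

lemma sum_law (Q : Ω → ℝ) (f : Ω → α) : ∑ a, law Q f a = ∑ ω, Q ω := by
  simpa using sum_law_mul Q f (fun _ => 1)

lemma entropy_law (Q : Ω → ℝ) (f : Ω → α) :
    entropy (law Q f) = -∑ ω, Q ω * Real.log (law Q f (f ω)) := by
  rw [entropy, sum_law_mul Q f fun a => Real.log (law Q f a)]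

/-- The entropy of a pushforward depends only on the partition into fibres. -/
lemma entropy_law_congr (Q : Ω → ℝ) {f : Ω → α} {g : Ω → β}
    (h : ∀ ω ω', f ω = f ω' ↔ g ω = g ω') : entropy (law Q f) = entropy (law Q g) := by
  rw [entropy_law, entropy_law]
  simp only [law, h]

/-- Strong subadditivity of Shannon entropy. -/
lemma entropy_law_submodular {Q : Ω → ℝ} (hQ : ∀ ω, 0 ≤ Q ω)
    (f : Ω → α) (g : Ω → β) (h : Ω → γ) :
    entropy (law Q fun ω => (f ω, g ω, h ω)) + entropy (law Q h) ≤
      entropy (law Q fun ω => (f ω, h ω)) + entropy (law Q fun ω => (g ω, h ω)) := by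
  set L := law Q fun ω => (f ω, g ω, h ω) with hL
  set Lf := law Q fun ω => (f ω, h ω) with hLf
  set Lg := law Q fun ω => (g ω, h ω) with hLg
  set Lh := law Q h with hLh
  let t : α × β × γ → ℝ := fun x => Lf (x.1, x.2.2) * Lg (x.2.1, x.2.2) / Lh x.2.2
  have ht : ∑ x, t x = ∑ ω, Q ω := by
    calc ∑ x, t x = ∑ c, ∑ b, ∑ a, Lf (a, c) * Lg (b, c) / Lh c := by
          simp only [Fintype.sum_prod_type, t]
          rw [Finset.sum_comm_cycle]
          exact Finset.sum_congr rfl fun c _ => Finset.sum_comm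
      _ = ∑ c, Lh c := by
          refine Finset.sum_congr rfl fun c _ => ?_
          simp only [← Finset.sum_div, ← Finset.sum_mul, ← Finset.mul_sum]
          rw [hLf, hLg, sum_law_prod, sum_law_prod, ← hLh, mul_self_div_self]
      _ = ∑ ω, Q ω := sum_law Q h
  have hle : ∑ ω, Q ω * (t (f ω, g ω, h ω) / L (f ω, g ω, h ω)) ≤ ∑ ω, Q ω := by
    rw [← sum_law_mul Q (fun ω => (f ω, g ω, h ω)) (fun x => t x / L x), ← ht]
    refine Finset.sum_le_sum fun x _ => ?_
    have h0 : 0 ≤ t x :=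
      div_nonneg (mul_nonneg (law_nonneg hQ _ _) (law_nonneg hQ _ _)) (law_nonneg hQ _ _)
    rw [← hL]
    by_cases hx : L x = 0
    · simp [hx, h0]
    · rw [mul_div_cancel₀ _ hx]
  have hterm : ∀ ω, Q ω * (Real.log (Lf (f ω, h ω)) + Real.log (Lg (g ω, h ω))
      - Real.log (Lh (h ω)) - Real.log (L (f ω, g ω, h ω))) ≤
      Q ω * (t (f ω, g ω, h ω) / L (f ω, g ω, h ω)) - Q ω := by
    intro ω
    rcases (hQ ω).eq_or_lt with h0 | h0
    · simp [← h0]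
    have p1 : 0 < L (f ω, g ω, h ω) := h0.trans_le (le_law_apply hQ (fun ω => (f ω, g ω, h ω)) ω)
    have p2 : 0 < Lf (f ω, h ω) := h0.trans_le (le_law_apply hQ (fun ω => (f ω, h ω)) ω)
    have p3 : 0 < Lg (g ω, h ω) := h0.trans_le (le_law_apply hQ (fun ω => (g ω, h ω)) ω)
    have p4 : 0 < Lh (h ω) := h0.trans_le (le_law_apply hQ h ω)
    have hlog : Real.log (t (f ω, g ω, h ω) / L (f ω, g ω, h ω)) =
        Real.log (Lf (f ω, h ω)) + Real.log (Lg (g ω, h ω))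
          - Real.log (Lh (h ω)) - Real.log (L (f ω, g ω, h ω)) := by
      simp only [t]
      rw [Real.log_div (by positivity) p1.ne', Real.log_div (by positivity) p4.ne',
        Real.log_mul p2.ne' p3.ne']
    rw [← hlog]
    have hpos : 0 < t (f ω, g ω, h ω) / L (f ω, g ω, h ω) := by
      simp only [t]; positivity
    nlinarith [Real.log_le_sub_one_of_pos hpos]
  have hsum := Finset.sum_le_sum fun ω (_ : ω ∈ Finset.univ) => hterm ω
  simp only [mul_sub, mul_add, Finset.sum_sub_distrib, Finset.sum_add_distrib] at hsum
  simp only [hL, hLf, hLg, hLh, entropy_law] at hsum hle ⊢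
  linarith

end Law

section Sites

variable {ι S : Type*}

lemma restrict_eq_restrict_iff {A : Finset ι} {ω ω' : ι → S} :
    A.restrict ω = A.restrict ω' ↔ ∀ p ∈ A, ω p = ω' p := by
  simp [funext_iff]

variable [Fintype ι] [DecidableEq ι] [Fintype S] [DecidableEq S]

/-- The entropy of the marginal on the set `A` of sites. -/
noncomputable def siteEntropy (Q : (ι → S) → ℝ) (A : Finset ι) : ℝ :=
  entropy (law Q A.restrict)

lemma entropy_law_eq_siteEntropy {α : Type*} [Fintype α] [DecidableEq α] (Q : (ι → S) → ℝ)
    {f : (ι → S) → α} {A : Finset ι} (h : ∀ ω ω', f ω = f ω' ↔ ∀ p ∈ A, ω p = ω' p) :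
    entropy (law Q f) = siteEntropy Q A :=
  entropy_law_congr Q fun ω ω' => (h ω ω').trans restrict_eq_restrict_iff.symm

lemma siteEntropy_univ (Q : (ι → S) → ℝ) : siteEntropy Q Finset.univ = entropy Q := by
  rw [← entropy_law_eq_siteEntropy Q (f := id) (by simp [funext_iff])]
  congr 1
  funext ω
  simp [law]

lemma siteEntropy_union_add_inter_le {Q : (ι → S) → ℝ} (hQ : ∀ ω, 0 ≤ Q ω) (A B : Finset ι) :
    siteEntropy Q (A ∪ B) + siteEntropy Q (A ∩ B) ≤ siteEntropy Q A + siteEntropy Q B := by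
  have h := entropy_law_submodular hQ (A.restrict (π := fun _ => S))
    (B.restrict (π := fun _ => S)) ((A ∩ B).restrict (π := fun _ => S))
  have hAB : ∀ ω ω' : ι → S, (A.restrict ω, B.restrict ω, (A ∩ B).restrict ω) =
      (A.restrict ω', B.restrict ω', (A ∩ B).restrict ω') ↔ ∀ p ∈ A ∪ B, ω p = ω' p := by
    simp only [Prod.mk.injEq, restrict_eq_restrict_iff, Finset.mem_union, Finset.mem_inter]
    grind
  have hA : ∀ ω ω' : ι → S, (A.restrict ω, (A ∩ B).restrict ω) =
      (A.restrict ω', (A ∩ B).restrict ω') ↔ ∀ p ∈ A, ω p = ω' p := by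
    simp only [Prod.mk.injEq, restrict_eq_restrict_iff, Finset.mem_inter]
    grind
  have hB : ∀ ω ω' : ι → S, (B.restrict ω, (A ∩ B).restrict ω) =
      (B.restrict ω', (A ∩ B).restrict ω') ↔ ∀ p ∈ B, ω p = ω' p := by
    simp only [Prod.mk.injEq, restrict_eq_restrict_iff, Finset.mem_inter]
    grind
  rwa [entropy_law_eq_siteEntropy Q hAB, entropy_law_eq_siteEntropy Q hA,
    entropy_law_eq_siteEntropy Q hB] at h

end Sites

section Rows

variable {S : Type*} [Fintype S] [DecidableEq S]

lemma margAB_law {Ω : Type*} [Fintype Ω] (Q : Ω → ℝ) (f : Ω → S × S × S × S) :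
    margAB (law Q f) = law Q fun ω => ((f ω).1, (f ω).2.1) := by
  funext p
  simp only [margAB, law]
  rw [← Fintype.sum_prod_type', Finset.sum_comm]
  refine Finset.sum_congr rfl fun ω _ => ?_
  rw [Fintype.sum_prod_type]
  by_cases h : ((f ω).1, (f ω).2.1) = p
  · subst h
    simp [Prod.ext_iff, ite_and]
  · rw [if_neg h]
    refine Finset.sum_eq_zero fun z _ => Finset.sum_eq_zero fun w _ => if_neg ?_
    intro h'
    simp [h'] at h

lemma margABD_law {Ω : Type*} [Fintype Ω] (Q : Ω → ℝ) (f : Ω → S × S × S × S) :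
    margABD (law Q f) = law Q fun ω => ((f ω).1, (f ω).2.1, (f ω).2.2.2) := by
  funext p
  simp only [margABD, law]
  rw [Finset.sum_comm]
  refine Finset.sum_congr rfl fun ω _ => ?_
  by_cases h : ((f ω).1, (f ω).2.1, (f ω).2.2.2) = p
  · subst h
    simp [Prod.ext_iff]
  · rw [if_neg h]
    refine Finset.sum_eq_zero fun z _ => if_neg ?_
    intro h'
    simp [h'] at h

/-- The sites of the first `k` rows, together with those of the last row from column `j` on. -/
def partialRows (N k j : ℕ) : Finset (Fin N × Fin (k + 1)) :=
  Finset.univ.filter fun p => p.2.1 < k ∨ j ≤ p.1.1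

lemma sum_glue_eq_law {N k : ℕ} (Q : (Fin N × Fin (k + 1) → S) → ℝ) :
    (fun ω' : Fin N × Fin k → S => ∑ r : Fin N → S,
        Q (fun p => if h : p.2.1 < k then ω' (p.1, ⟨p.2.1, h⟩) else r p.1)) =
      law Q fun ω p => ω (p.1, p.2.castSucc) := by
  funext ω'
  rw [law, ← Finset.sum_filter]
  refine Finset.sum_nbij' (fun r p => if h : p.2.1 < k then ω' (p.1, ⟨p.2.1, h⟩) else r p.1)
    (fun ω i => ω (i, Fin.last k)) ?_ ?_ ?_ ?_ ?_
  · intro r _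
    simp
  · simp
  · intro r _
    simp
  · intro ω hω
    simp only [Finset.mem_filter, Finset.mem_univ, true_and] at hω
    subst hω
    funext p
    obtain ⟨i, j⟩ := p
    by_cases h : j.1 < k
    · simp [h]
    · have : j = Fin.last k := Fin.ext (by simp; omega)
      simp [this]
  · simp

lemma entropy_first_rows {N k : ℕ} (Q : (Fin N × Fin (k + 1) → S) → ℝ) :
    entropy (fun ω' : Fin N × Fin k → S => ∑ r : Fin N → S,
        Q (fun p => if h : p.2.1 < k then ω' (p.1, ⟨p.2.1, h⟩) else r p.1)) =
      siteEntropy Q (partialRows N k N) := by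
  rw [sum_glue_eq_law]
  refine entropy_law_eq_siteEntropy Q fun ω ω' => ?_
  simp only [funext_iff, Prod.forall, partialRows, Finset.mem_filter, Finset.mem_univ, true_and]
  refine ⟨fun h i j hj => ?_, fun h i j => h i _ (Or.inl j.2)⟩
  have hj' : j.1 < k := hj.resolve_right (by omega)
  exact h i ⟨j.1, hj'⟩

/-- Adjoining the site of the last row in column `j` raises the entropy by at most
`H(P) - H(P_abd)`; adjoining the last two sites of that row to the first `k` rows raises it by at
most `H(P) - H(P_ab)`. -/
lemma siteEntropy_partialRows_le {N k : ℕ} (hk : 1 ≤ k) {P : S × S × S × S → ℝ}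
    {Q : (Fin N × Fin (k + 1) → S) → ℝ} (hQ : ∀ ω, 0 ≤ Q ω) (hQP : Consistent Q P)
    {j : ℕ} (hj : j + 1 < N) :
    siteEntropy Q (partialRows N k j) + entropy (margABD P) ≤
        siteEntropy Q (partialRows N k (j + 1)) + entropy P ∧
      (j + 2 = N → siteEntropy Q (partialRows N k j) + entropy (margAB P) ≤
        siteEntropy Q (partialRows N k N) + entropy P) := by
  have hP : law Q (fun ω => cluster ω ⟨j, by omega⟩ ⟨k - 1, by omega⟩) = P := hQP _ _
  let a : Fin N × Fin (k + 1) := (⟨j, by omega⟩, ⟨k - 1, by omega⟩)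
  let b : Fin N × Fin (k + 1) := (⟨j + 1, hj⟩, ⟨k - 1, by omega⟩)
  let c : Fin N × Fin (k + 1) := (⟨j, by omega⟩, ⟨k - 1 + 1, by omega⟩)
  let d : Fin N × Fin (k + 1) := (⟨j + 1, hj⟩, ⟨k - 1 + 1, by omega⟩)
  have h4 : entropy P = siteEntropy Q {a, b, c, d} := by
    rw [← hP]
    exact entropy_law_eq_siteEntropy Q fun ω ω' => by simp [cluster, a, b, c, d]
  have h3 : entropy (margABD P) = siteEntropy Q {a, b, d} := by
    rw [← hP, margABD_law]
    exact entropy_law_eq_siteEntropy Q fun ω ω' => by simp [cluster, a, b, d]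
  have h2 : entropy (margAB P) = siteEntropy Q {a, b} := by
    rw [← hP, margAB_law]
    exact entropy_law_eq_siteEntropy Q fun ω ω' => by simp [cluster, a, b]
  rw [h4, h3, h2]
  constructor
  · convert siteEntropy_union_add_inter_le hQ (partialRows N k (j + 1)) {a, b, c, d} using 3
    · ext ⟨x, y⟩
      simp [partialRows, a, b, c, d, Prod.ext_iff, Fin.ext_iff]
      omega
    · ext ⟨x, y⟩
      simp [partialRows, a, b, c, d, Prod.ext_iff, Fin.ext_iff]
      omega
  · intro hN
    convert siteEntropy_union_add_inter_le hQ (partialRows N k N) {a, b, c, d} using 3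
    · ext ⟨x, y⟩
      simp [partialRows, a, b, c, d, Prod.ext_iff, Fin.ext_iff]
      omega
    · ext ⟨x, y⟩
      simp [partialRows, a, b, c, d, Prod.ext_iff, Fin.ext_iff]
      omega

end Rows

/-- Eq. (31) of the paper, recursive entropy bound: if `Q` is a
probability distribution on `(k+1)`-row configurations consistent with `P` (which obeys
`C_L` and `C_M`), and `Q'` is its marginal on the first `k` rows, then
`H(Q) ≤ H(Q') + (N−1)·H(P) − (N−2)·H(P_abd) − H(P_ab)`. -/
theorem entropy_recursive_bound
    {S : Type*} [Fintype S] [DecidableEq S] [Nonempty S]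
    (P : S × S × S × S → ℝ) (hP : IsProbDist P) (hCL : CL P) (hCM : CM P)
    (N k : ℕ) (hN : 2 ≤ N) (hk : 2 ≤ k)
    (Q : (Fin N × Fin (k + 1) → S) → ℝ) (hQ : IsProbDist Q) (hQP : Consistent Q P) :
    -- `Q'` is the marginal of `Q` on the first `k` rows
    let Q' : (Fin N × Fin k → S) → ℝ :=
      fun ω' => ∑ r : Fin N → S,
        Q (fun p => if h : p.2.1 < k then ω' (p.1, ⟨p.2.1, h⟩) else r p.1)
    entropy Q ≤ entropy Q' + ((N : ℝ) - 1) * entropy P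
        - ((N : ℝ) - 2) * entropy (margABD P) - entropy (margAB P) := by
  intro Q'
  have key : ∀ m : ℕ, m + 2 ≤ N →
      siteEntropy Q (partialRows N k (N - 2 - m)) ≤ siteEntropy Q (partialRows N k N)
        + ((m : ℝ) + 1) * entropy P - m * entropy (margABD P) - entropy (margAB P) := by
    intro m
    induction m with
    | zero =>
      intro _
      have h := (siteEntropy_partialRows_le (by omega) hQ.1 hQP
        (j := N - 2) (by omega)).2 (by omega)
      simp only [Nat.sub_zero, Nat.cast_zero]
      linarith
    | succ m ih =>
      intro hm
      have h := (siteEntropy_partialRows_le (by omega) hQ.1 hQP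
        (j := N - 2 - (m + 1)) (by omega)).1
      rw [show N - 2 - (m + 1) + 1 = N - 2 - m by omega] at h
      have := ih (by omega)
      push_cast
      linarith
  have h := key (N - 2) (by omega)
  have huniv : partialRows N k (N - 2 - (N - 2)) = Finset.univ := by
    ext p
    simp [partialRows]
  rw [huniv, siteEntropy_univ, ← entropy_first_rows Q, Nat.cast_sub hN] at h
  push_cast at h
  linarith
end
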